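/- Let W(r) ⊂ ℝ³ be the 14-point set consisting of (±1,0,0), (0,±1,0), (0,0,±1) together with the eight points (ar/3, br/3, cr/3) for a,b,c ∈ {+1,-1}, for a parameter r>0, and set r₀ = 3·2^{-3/4}. A continuous function f:ℝ³→ℝ satisfies f(x) = (1/14)·Σ_{v∈W(r)} f(x+s·v) for all x∈ℝ³ and all s>0 if and only if: (when r=r₀) f coincides with the function of a polynomial p∈ℝ[x₁,x₂,x₃] satisfying e₂(∂)p = e₆(∂)p = e₄(∂)²p = 0; and (when r≠r₀) f coincides with the function of a polynomial p satisfying e₂(∂)p = e₄(∂)p = e₆(∂)p = 0. -/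

import Mathlib

open MvPolynomial

noncomputable def dop (φ : MvPolynomial (Fin 3) ℝ) :
    MvPolynomial (Fin 3) ℝ →ₗ[ℝ] MvPolynomial (Fin 3) ℝ :=
  φ.support.sum fun s => φ.coeff s •
    (((pderiv (0 : Fin 3)).toLinearMap ^ s 0) *
     ((pderiv (1 : Fin 3)).toLinearMap ^ s 1) *
     ((pderiv (2 : Fin 3)).toLinearMap ^ s 2))

noncomputable def e2 : MvPolynomial (Fin 3) ℝ := X 0 ^ 2 + X 1 ^ 2 + X 2 ^ 2
noncomputable def e4 : MvPolynomial (Fin 3) ℝ :=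
  X 1 ^ 2 * X 2 ^ 2 + X 2 ^ 2 * X 0 ^ 2 + X 0 ^ 2 * X 1 ^ 2
noncomputable def e6 : MvPolynomial (Fin 3) ℝ := X 0 ^ 2 * X 1 ^ 2 * X 2 ^ 2

/-- A sign `±1` attached to a boolean. -/
def sg (b : Bool) : ℝ := if b then 1 else -1

/-- Vertices of the regular octahedron. -/
def vA (a : Bool) : Fin 3 → ℝ := ![sg a, 0, 0]
def vB (b : Bool) : Fin 3 → ℝ := ![0, sg b, 0]
def vC (c : Bool) : Fin 3 → ℝ := ![0, 0, sg c]

/-- Apex vertices of the isohedral triakis octahedron with parameter `r`. -/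
noncomputable def vD (r : ℝ) (a b c : Bool) : Fin 3 → ℝ :=
  ![sg a * r / 3, sg b * r / 3, sg c * r / 3]

open scoped fwdDiff

section Annihilator

variable {A M : Type*} [CommRing A] [Algebra ℝ A] [AddCommGroup M] [Module ℝ M]

/-- The ideal of all elements of a commutative algebra that kill a given vector of a
representation. -/
def annihilatorIdeal (ρ : A →ₐ[ℝ] Module.End ℝ M) (m : M) : Ideal A where
  carrier := {a | ρ a m = 0}
  add_mem' {a b} ha hb := by
    have ha' : ρ a m = 0 := ha
    have hb' : ρ b m = 0 := hb
    simp [ha', hb']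
  zero_mem' := by simp
  smul_mem' c a ha := by
    have ha' : ρ a m = 0 := ha
    simp [ha']

lemma mem_annihilatorIdeal {ρ : A →ₐ[ℝ] Module.End ℝ M} {m : M} {a : A} :
    a ∈ annihilatorIdeal ρ m ↔ ρ a m = 0 := Iff.rfl

end Annihilator

section Newton

variable {σ R : Type*} [Fintype σ] [CommRing R] [Algebra ℚ R]

lemma aeval_esymm_congr_of_psum {t u : σ → R}
    (h : ∀ k, 0 < k → ∑ i, t i ^ k = ∑ i, u i ^ k) (k : ℕ) :
    aeval t (esymm σ ℚ k) = aeval u (esymm σ ℚ k) := by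
  induction k using Nat.strong_induction_on with
  | _ k ih =>
    rcases Nat.eq_zero_or_pos k with rfl | hk
    · simp
    have hu : IsUnit (k : R) := by
      have : IsUnit (k : ℚ) := (Nat.cast_ne_zero.mpr hk.ne').isUnit
      simpa using this.map (algebraMap ℚ R)
    refine hu.mul_left_cancel ?_
    have h₁ := congrArg (aeval t) (mul_esymm_eq_sum σ ℚ k)
    have h₂ := congrArg (aeval u) (mul_esymm_eq_sum σ ℚ k)
    simp only [map_mul, map_natCast, map_pow, map_neg, map_one, map_sum] at h₁ h₂
    rw [h₁, h₂]
    congr 1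
    refine Finset.sum_congr rfl fun a ha => ?_
    obtain ⟨ha, hlt⟩ := Finset.mem_filter.mp ha
    have hsum := Finset.HasAntidiagonal.mem_antidiagonal.mp ha
    rw [ih _ hlt]
    simp only [psum, map_sum, map_pow, aeval_X]
    rw [h _ (by omega)]

/-- If the power sums of finitely many elements are those of the constant family `1`, then each
of these elements is unipotent. -/
lemma sub_one_pow_card_eq_zero {t : σ → R}
    (h : ∀ k, 0 < k → ∑ i, t i ^ k = Fintype.card σ) (i : σ) :
    (t i - 1) ^ Fintype.card σ = 0 := by
  have he : ∀ k, (Finset.univ.val.map t).esymm k =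
      (Finset.univ.val.map fun _ : σ => (1 : R)).esymm k := fun k => by
    rw [← aeval_esymm_eq_multiset_esymm σ ℚ, ← aeval_esymm_eq_multiset_esymm σ ℚ]
    exact aeval_esymm_congr_of_psum (by simpa using h) k
  have h₁ := Multiset.prod_X_sub_X_eq_sum_esymm (Finset.univ.val.map t)
  have h₂ := Multiset.prod_X_sub_X_eq_sum_esymm (Finset.univ.val.map fun _ : σ => (1 : R))
  simp only [Multiset.card_map, he] at h₁ h₂
  have h₃ := congrArg (Polynomial.eval (t i)) (h₁.trans h₂.symm)
  simp only [Multiset.map_map] at h₃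
  change Polynomial.eval (t i) (∏ j : σ, (Polynomial.X - Polynomial.C (t j))) =
    Polynomial.eval (t i) (∏ j : σ, (Polynomial.X - Polynomial.C 1)) at h₃
  rw [Polynomial.eval_prod, Polynomial.eval_prod,
    Finset.prod_eq_zero (Finset.mem_univ i) (by simp)] at h₃
  simpa using h₃.symm

end Newton

section Translation

variable {E : Type*} [AddCommGroup E]

/-- The action of the group algebra of `E` on real functions on `E` by translations. -/
noncomputable def translationHom :
    AddMonoidAlgebra ℝ E →ₐ[ℝ] Module.End ℝ (E → ℝ) :=
  AddMonoidAlgebra.lift ℝ _ E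
    { toFun := fun h => LinearMap.funLeft ℝ ℝ (· + h.toAdd)
      map_one' := by ext; simp [LinearMap.funLeft]
      map_mul' := fun g h => by
        ext f x
        simp [LinearMap.funLeft, add_comm, add_left_comm] }

lemma translationHom_single (h : E) (f : E → ℝ) (x : E) :
    translationHom (AddMonoidAlgebra.single h 1) f x = f (x + h) := by
  simp [translationHom, LinearMap.funLeft]

lemma translationHom_sub_one_pow (h : E) (n : ℕ) (f : E → ℝ) :
    translationHom ((AddMonoidAlgebra.single h 1 - 1) ^ n) f = Δ_[h] ^[n] f := by
  rw [map_pow, Module.End.pow_apply]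
  congr 1
  ext g x
  simp [fwdDiff, translationHom_single]

/-- A function with the mean value property at all integer scales has vanishing iterated
differences along the vectors involved. -/
lemma fwdDiff_iter_card_eq_zero {ι : Type*} [Fintype ι] (w : ι → E) (f : E → ℝ)
    (hf : ∀ x (k : ℕ), 0 < k → ∑ i, f (x + k • w i) = Fintype.card ι * f x) (i : ι) :
    Δ_[w i] ^[Fintype.card ι] f = 0 := by
  let I := annihilatorIdeal (translationHom (E := E)) f
  have key : ∀ k, 0 < k →
      ∑ i, Ideal.Quotient.mk I (AddMonoidAlgebra.single (w i) 1) ^ k = Fintype.card ι := by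
    intro k hk
    rw [← sub_eq_zero, ← map_natCast (Ideal.Quotient.mk I)]
    simp only [← map_pow]
    rw [← map_sum, ← map_sub, Ideal.Quotient.eq_zero_iff_mem, mem_annihilatorIdeal]
    ext x
    simp [AddMonoidAlgebra.single_pow, translationHom_single, hf x k hk]
  let _ : Algebra ℚ (AddMonoidAlgebra ℝ E ⧸ I) :=
    ((algebraMap ℝ (AddMonoidAlgebra ℝ E ⧸ I)).comp (algebraMap ℚ ℝ)).toAlgebra
  have h := sub_one_pow_card_eq_zero key i
  rw [← map_one (Ideal.Quotient.mk I), ← map_sub, ← map_pow, Ideal.Quotient.eq_zero_iff_mem,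
    mem_annihilatorIdeal, translationHom_sub_one_pow] at h
  exact h

end Translation

section Frechet

lemma exists_polynomial_of_fwdDiff_iter_eq_zero {h : ℝ} {n : ℕ} {g : ℝ → ℝ}
    (hg : Δ_[h] ^[n] g = 0) (y : ℝ) :
    ∃ q : Polynomial ℝ, q.degree < n ∧ ∀ j : ℕ, g (y + j * h) = q.eval (j : ℝ) := by
  refine ⟨∑ k ∈ Finset.range n,
    Polynomial.C (Δ_[h] ^[k] g y / k.factorial) * descPochhammer ℝ k, ?_, fun j => ?_⟩
  · rw [← Polynomial.mem_degreeLT]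
    refine Submodule.sum_mem _ fun k hk => ?_
    rw [Polynomial.mem_degreeLT]
    refine Polynomial.degree_le_natDegree.trans_lt ?_
    have := (Polynomial.natDegree_C_mul_le (Δ_[h] ^[k] g y / k.factorial)
      (descPochhammer ℝ k)).trans_eq (descPochhammer_natDegree ℝ k)
    exact_mod_cast this.trans_lt (Finset.mem_range.mp hk)
  · have hzero : ∀ k, n ≤ k → Δ_[h] ^[k] g y = 0 := fun k hk => by
      obtain ⟨m, rfl⟩ := Nat.exists_eq_add_of_le' hk
      rw [Function.iterate_add_apply, hg]
      have := fwdDiff_iter_const_smul (h := h) (0 : ℝ) (0 : ℝ → ℝ) m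
      simpa using congrFun this y
    have hs := shift_eq_sum_fwdDiff_iter h g j y
    rw [nsmul_eq_mul] at hs
    rw [hs, Polynomial.eval_finsetSum]
    trans ∑ k ∈ Finset.range (n + j + 1), (j.choose k : ℝ) * Δ_[h] ^[k] g y
    · simp only [nsmul_eq_mul]
      refine Finset.sum_subset (Finset.range_mono (by omega)) fun k _ hk => ?_
      rw [Nat.choose_eq_zero_of_lt (by simpa using hk)]
      simp
    · symm
      have hterm : ∀ k, Polynomial.eval (j : ℝ)
          (Polynomial.C (Δ_[h] ^[k] g y / k.factorial) * descPochhammer ℝ k) =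
            (j.choose k : ℝ) * Δ_[h] ^[k] g y := fun k => by
        rw [Polynomial.eval_mul, Polynomial.eval_C, descPochhammer_eval_eq_descFactorial,
          Nat.descFactorial_eq_factorial_mul_choose]
        have : (k.factorial : ℝ) ≠ 0 := by positivity
        push_cast
        field_simp
      simp only [hterm]
      refine Finset.sum_subset (Finset.range_mono (by omega)) fun k _ hk => ?_
      rw [hzero k (by simpa using hk), mul_zero]

/-- Fréchet's theorem: a continuous function on the line whose `n`-th differences vanish is the
polynomial interpolating it at `0, …, n - 1`. -/
lemma eq_interpolate_of_fwdDiff_iter_eq_zero {n : ℕ} {g : ℝ → ℝ} (hc : Continuous g)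
    (hg : ∀ h : ℝ, 0 < h → Δ_[h] ^[n] g = 0) (s : ℝ) :
    g s = (Lagrange.interpolate (Finset.range n) (fun j : ℕ => (j : ℝ)) fun j => g j).eval s := by
  set P := Lagrange.interpolate (Finset.range n) (fun j : ℕ => (j : ℝ)) fun j => g j with hP
  have hinj : Set.InjOn (fun j : ℕ => (j : ℝ)) (Finset.range n) := Nat.cast_injective.injOn
  have hPdeg : P.degree < n := by
    have := Lagrange.degree_interpolate_lt (fun j : ℕ => g j) hinj
    rwa [Finset.card_range] at this
  refine congrFun (hc.ext_on Rat.denseRange_cast P.continuous ?_) s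
  rintro _ ⟨a, rfl⟩
  set m := a.den
  have hm : (0 : ℝ) < m := by exact_mod_cast a.den_pos
  set K := a.num.natAbs
  obtain ⟨q, hqdeg, hq⟩ :=
    exists_polynomial_of_fwdDiff_iter_eq_zero (hg (m : ℝ)⁻¹ (by positivity)) (-(K : ℝ))
  have hcomp : q = P.comp (Polynomial.C (-(K : ℝ)) + Polynomial.C (m : ℝ)⁻¹ * Polynomial.X) := by
    refine Polynomial.eq_of_degrees_lt_of_eval_index_eq (Finset.range n)
      (v := fun j : ℕ => (((K + j) * m : ℕ) : ℝ)) ?_ (by simpa using hqdeg) ?_ ?_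
    · intro i _ j _ hij
      have hij' : (K + i) * m = (K + j) * m := Nat.cast_injective hij
      have := Nat.eq_of_mul_eq_mul_right a.den_pos hij'
      omega
    · rw [Finset.card_range]
      refine lt_of_le_of_lt ?_ hPdeg
      by_cases hP0 : P = 0
      · simp [hP0]
      refine Polynomial.degree_le_natDegree.trans ?_
      rw [Polynomial.degree_eq_natDegree hP0, Polynomial.natDegree_comp]
      have hlin : (Polynomial.C (-(K : ℝ)) + Polynomial.C (m : ℝ)⁻¹ * Polynomial.X).natDegree
          ≤ 1 := by
        compute_degree
      exact_mod_cast (Nat.mul_le_mul_left _ hlin).trans_eq (mul_one _)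
    · intro j hj
      have harg : -(K : ℝ) + (((K + j) * m : ℕ) : ℝ) * (m : ℝ)⁻¹ = j := by
        push_cast
        field_simp
        ring
      rw [← hq, harg, Polynomial.eval_comp]
      have harg' : Polynomial.eval (((K + j) * m : ℕ) : ℝ)
          (Polynomial.C (-(K : ℝ)) + Polynomial.C (m : ℝ)⁻¹ * Polynomial.X) = j := by
        rw [← harg]
        simp only [Polynomial.eval_add, Polynomial.eval_mul, Polynomial.eval_C, Polynomial.eval_X]
        ring
      rw [harg']
      exact (Lagrange.eval_interpolate_at_node (fun j : ℕ => g j) hinj hj).symm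
  have hnn : 0 ≤ (K : ℤ) * m + a.num := by
    have h₁ : (K : ℤ) = |a.num| := Int.natCast_natAbs _
    have h₂ : (1 : ℤ) ≤ m := by exact_mod_cast a.den_pos
    have h₃ := neg_abs_le a.num
    nlinarith [abs_nonneg a.num]
  obtain ⟨j, hj⟩ := Int.eq_ofNat_of_zero_le hnn
  have hjr : (K : ℝ) * m + a.num = j := by exact_mod_cast hj
  have harg : -(K : ℝ) + j * (m : ℝ)⁻¹ = a := by
    rw [← hjr, Rat.cast_def a]
    field_simp
    ring
  have hqj := hq j
  rw [harg, hcomp, Polynomial.eval_comp] at hqj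
  rw [hqj]
  congr 1
  rw [← harg]
  simp only [Polynomial.eval_add, Polynomial.eval_mul, Polynomial.eval_C, Polynomial.eval_X]
  ring

/-- A continuous function on `ℝ³` whose `n`-th differences along the coordinate axes vanish is a
polynomial. -/
lemma exists_mvPolynomial_of_fwdDiff_iter_eq_zero {n : ℕ} {f : (Fin 3 → ℝ) → ℝ}
    (hc : Continuous f)
    (hf : ∀ (i : Fin 3) (h : ℝ), 0 < h → Δ_[Pi.single i h] ^[n] f = 0) :
    ∃ p : MvPolynomial (Fin 3) ℝ, ∀ x, f x = eval x p := by
  let L : ℕ → Polynomial ℝ := Lagrange.basis (Finset.range n) fun j : ℕ => (j : ℝ)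
  have step : ∀ (i : Fin 3) (x : Fin 3 → ℝ) (s : ℝ), f (Function.update x i s) =
      ∑ j ∈ Finset.range n, f (Function.update x i (j : ℝ)) * (L j).eval s := by
    intro i x s
    have hline : ∀ (h : ℝ) (k : ℕ) (u : ℝ), Δ_[h] ^[k] (fun u => f (Function.update x i u)) u =
        Δ_[Pi.single i h] ^[k] f (Function.update x i u) := by
      intro h k
      induction k with
      | zero => intro u; rfl
      | succ k ih =>
        intro u
        rw [Function.iterate_succ_apply', Function.iterate_succ_apply', fwdDiff, fwdDiff, ih, ih]
        have hstep : Function.update x i (u + h) = Function.update x i u + Pi.single i h := by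
          ext l
          by_cases hl : l = i
          · subst hl; simp
          · simp [hl]
        rw [hstep]
    have := eq_interpolate_of_fwdDiff_iter_eq_zero (n := n)
      (g := fun u => f (Function.update x i u)) (by fun_prop)
      (fun h hh => by ext u; rw [hline, hf i h hh]; rfl) s
    simpa [Lagrange.interpolate_apply, Polynomial.eval_finsetSum] using this
  refine ⟨∑ j ∈ Finset.range n, ∑ k ∈ Finset.range n, ∑ l ∈ Finset.range n,
    C (f ![(j : ℝ), k, l]) * (Polynomial.aeval (X 2) (L l) * Polynomial.aeval (X 1) (L k) *
      Polynomial.aeval (X 0) (L j)), fun x => ?_⟩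
  have heval : ∀ (i : Fin 3) (q : Polynomial ℝ),
      eval x (Polynomial.aeval (X i : MvPolynomial (Fin 3) ℝ) q) = q.eval (x i) := by
    intro i q
    rw [← coe_aeval_eq_eval, RingHom.coe_coe, ← Polynomial.aeval_algHom_apply]
    simp
  simp only [map_sum, map_mul, eval_C, heval]
  conv_lhs => rw [← Function.update_eq_self 0 x]
  rw [step]
  refine Finset.sum_congr rfl fun j _ => ?_
  conv_lhs => rw [← Function.update_eq_self 1 (Function.update x 0 (j : ℝ))]
  rw [step, Finset.sum_mul]
  refine Finset.sum_congr rfl fun k _ => ?_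
  conv_lhs => rw [← Function.update_eq_self 2
    (Function.update (Function.update x 0 (j : ℝ)) 1 (k : ℝ))]
  rw [step, Finset.sum_mul, Finset.sum_mul]
  refine Finset.sum_congr rfl fun l _ => ?_
  have hpt : Function.update (Function.update (Function.update x 0 (j : ℝ)) 1 (k : ℝ)) 2 (l : ℝ) =
      ![(j : ℝ), k, l] := by
    ext i
    fin_cases i <;> simp [Function.update]
  rw [hpt]
  simp [Function.update, mul_assoc]

end Frechet

section DifferentialOperators

lemma pderiv_pderiv_comm (i j : Fin 3) (p : MvPolynomial (Fin 3) ℝ) :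
    pderiv i (pderiv j p) = pderiv j (pderiv i p) := by
  have h : ⁅pderiv (R := ℝ) i, pderiv (R := ℝ) j⁆ = 0 := by
    refine MvPolynomial.derivation_ext fun k => ?_
    simp [Derivation.commutator_apply, pderiv_X, Pi.single_apply, apply_ite]
  have := congrArg (fun D => D p) h
  simpa [Derivation.commutator_apply, sub_eq_zero] using this

lemma commute_pderiv (i j : Fin 3) :
    Commute (pderiv (R := ℝ) i).toLinearMap (pderiv j).toLinearMap :=
  LinearMap.ext (pderiv_pderiv_comm i j)

/-- The substitution `φ ↦ φ(∂)` as an algebra homomorphism. -/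
noncomputable def dopHom :
    MvPolynomial (Fin 3) ℝ →ₐ[ℝ] Module.End ℝ (MvPolynomial (Fin 3) ℝ) :=
  AddMonoidAlgebra.lift ℝ _ (Fin 3 →₀ ℕ)
    { toFun := fun s => (pderiv 0).toLinearMap ^ s.toAdd 0 * (pderiv 1).toLinearMap ^ s.toAdd 1 *
        (pderiv 2).toLinearMap ^ s.toAdd 2
      map_one' := by simp
      map_mul' := fun s t => by
        simp only [toAdd_mul, Finsupp.add_apply, pow_add]
        have h₁ := (commute_pderiv 1 0).pow_pow (s.toAdd 1) (t.toAdd 0)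
        have h₂ := (commute_pderiv 2 0).pow_pow (s.toAdd 2) (t.toAdd 0)
        have h₃ := (commute_pderiv 2 1).pow_pow (s.toAdd 2) (t.toAdd 1)
        simp only [mul_assoc]
        rw [h₂.left_comm, h₃.left_comm, h₁.left_comm] }

lemma dopHom_apply (φ : MvPolynomial (Fin 3) ℝ) : dopHom φ = dop φ :=
  AddMonoidAlgebra.lift_apply _ _

lemma dopHom_X (i : Fin 3) : dopHom (X i) = (pderiv i).toLinearMap := by
  have : (X i : MvPolynomial (Fin 3) ℝ) = AddMonoidAlgebra.single (Finsupp.single i 1) 1 := rfl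
  rw [this, dopHom, AddMonoidAlgebra.lift_single]
  fin_cases i <;> simp

/-- The linear form dual to a vector. -/
noncomputable def linForm (v : Fin 3 → ℝ) : MvPolynomial (Fin 3) ℝ := ∑ i, C (v i) * X i

/-- Restriction of a polynomial to the line through `x` with direction `v`. -/
noncomputable def restrictLine (x v : Fin 3 → ℝ) :
    MvPolynomial (Fin 3) ℝ →ₐ[ℝ] Polynomial ℝ :=
  aeval fun i => Polynomial.C (x i) + Polynomial.X * Polynomial.C (v i)

lemma eval_restrictLine (x v : Fin 3 → ℝ) (p : MvPolynomial (Fin 3) ℝ) (s : ℝ) :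
    (restrictLine x v p).eval s = eval (x + s • v) p := by
  induction p using MvPolynomial.induction_on with
  | C a => simp [restrictLine]
  | add p q hp hq => simp [hp, hq]
  | mul_X p i hp =>
    rw [map_mul, map_mul, Polynomial.eval_mul, hp]
    simp [restrictLine, mul_comm s]

lemma dopHom_linForm (v : Fin 3 → ℝ) (p : MvPolynomial (Fin 3) ℝ) :
    dopHom (linForm v) p = ∑ i, v i • pderiv i p := by
  simp [linForm, ← smul_eq_C_mul, dopHom_X]

lemma derivative_restrictLine (x v : Fin 3 → ℝ) (p : MvPolynomial (Fin 3) ℝ) :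
    (restrictLine x v p).derivative = restrictLine x v (dopHom (linForm v) p) := by
  rw [dopHom_linForm]
  induction p using MvPolynomial.induction_on with
  | C a => simp [restrictLine]
  | add p q hp hq => simp only [map_add, hp, hq, smul_add, Finset.sum_add_distrib]
  | mul_X p i hp =>
    rw [map_mul, Polynomial.derivative_mul, hp]
    simp only [Derivation.leibniz, pderiv_X, smul_add, Finset.sum_add_distrib, map_add, map_sum,
      map_smul, smul_eq_mul, map_mul, Pi.single_apply]
    have hX : Polynomial.derivative (restrictLine x v (X i)) = Polynomial.C (v i) := by
      simp [restrictLine]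
    rw [hX, Finset.sum_mul, add_comm]
    congr 1
    · rw [Finset.sum_eq_single i] <;> simp +contextual [Polynomial.smul_eq_C_mul, mul_comm, eq_comm]
    · refine Finset.sum_congr rfl fun j _ => ?_
      rw [smul_mul_assoc, mul_comm]

lemma iterate_derivative_restrictLine (x v : Fin 3 → ℝ) (p : MvPolynomial (Fin 3) ℝ) (k : ℕ) :
    Polynomial.derivative^[k] (restrictLine x v p) =
      restrictLine x v (dopHom (linForm v ^ k) p) := by
  induction k with
  | zero => simp
  | succ k ih =>
    rw [Function.iterate_succ_apply', ih, derivative_restrictLine, pow_succ', map_mul]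
    rfl

/-- For polynomials, the mean value property amounts to the differential equations given by the
power sums of the linear forms. -/
lemma meanValue_iff_powerSum {ι : Type*} [Fintype ι] (w : ι → Fin 3 → ℝ)
    (p : MvPolynomial (Fin 3) ℝ) :
    (∀ (x : Fin 3 → ℝ) (s : ℝ), 0 < s →
        ∑ i, eval (x + s • w i) p = Fintype.card ι * eval x p) ↔
      ∀ k, 0 < k → dopHom (∑ i, linForm (w i) ^ k) p = 0 := by
  have hder : ∀ (x : Fin 3 → ℝ) (k : ℕ),
      (Polynomial.derivative^[k] (∑ i, restrictLine x (w i) p)).eval 0 =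
        eval x (dopHom (∑ i, linForm (w i) ^ k) p) := by
    intro x k
    rw [Polynomial.iterate_derivative_sum, Polynomial.eval_finsetSum, map_sum,
      LinearMap.sum_apply, map_sum]
    refine Finset.sum_congr rfl fun i _ => ?_
    rw [iterate_derivative_restrictLine, eval_restrictLine, zero_smul, add_zero]
  have heval : ∀ (x : Fin 3 → ℝ) (s : ℝ), (∑ i, restrictLine x (w i) p).eval s =
      ∑ i, eval (x + s • w i) p := fun x s => by
    simp only [Polynomial.eval_finsetSum, eval_restrictLine]
  constructor
  · intro h k hk
    refine MvPolynomial.funext fun x => ?_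
    have hconst : ∑ i, restrictLine x (w i) p = Polynomial.C (Fintype.card ι * eval x p) := by
      refine Polynomial.eq_of_infinite_eval_eq _ _ ((Set.Ioi_infinite (0 : ℝ)).mono ?_)
      intro s hs
      simpa [heval] using h x s hs
    rw [← hder, hconst, Polynomial.iterate_derivative_C hk]
    simp
  · intro h x s _
    have hconst : ∑ i, restrictLine x (w i) p =
        Polynomial.C ((∑ i, restrictLine x (w i) p).coeff 0) := by
      ext k
      rcases Nat.eq_zero_or_pos k with rfl | hk
      · simp
      have h0 := hder x k
      rw [h k hk, map_zero, ← Polynomial.coeff_zero_eq_eval_zero,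
        Polynomial.coeff_iterate_derivative, zero_add, Nat.descFactorial_self, nsmul_eq_mul] at h0
      rw [Polynomial.coeff_C, if_neg hk.ne']
      exact (mul_eq_zero.mp h0).resolve_left (by positivity)
    rw [← heval, hconst, Polynomial.eval_C, Polynomial.coeff_zero_eq_eval_zero, heval]
    simp

end DifferentialOperators

section PowerSums

variable {R : Type*} [CommRing R]

/-- The power sum of the linear forms `±x, ±y, ±z, τ(±x ± y ± z)`. -/
def vertexPowerSum (τ x y z : R) (k : ℕ) : R :=
  (x ^ k + (-x) ^ k) + (y ^ k + (-y) ^ k) + (z ^ k + (-z) ^ k) +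
    τ ^ k * (((x + y + z) ^ k + (-(x + y + z)) ^ k) + ((x + y - z) ^ k + (-(x + y - z)) ^ k) +
      ((x - y + z) ^ k + (-(x - y + z)) ^ k) + ((-x + y + z) ^ k + (-(-x + y + z)) ^ k))

lemma vertexPowerSum_two (τ x y z : R) :
    vertexPowerSum τ x y z 2 = (2 + 8 * τ ^ 2) * (x ^ 2 + y ^ 2 + z ^ 2) := by
  unfold vertexPowerSum; ring

lemma vertexPowerSum_four {τ x y z : R} (h2 : x ^ 2 + y ^ 2 + z ^ 2 = 0) :
    vertexPowerSum τ x y z 4 =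
      (32 * τ ^ 4 - 4) * (y ^ 2 * z ^ 2 + z ^ 2 * x ^ 2 + x ^ 2 * y ^ 2) := by
  unfold vertexPowerSum
  linear_combination (2 + 8 * τ ^ 4) * (x ^ 2 + y ^ 2 + z ^ 2) * h2

lemma vertexPowerSum_six {τ x y z : R} (h2 : x ^ 2 + y ^ 2 + z ^ 2 = 0) :
    vertexPowerSum τ x y z 6 = (6 + 384 * τ ^ 6) * (x ^ 2 * y ^ 2 * z ^ 2) := by
  unfold vertexPowerSum
  linear_combination ((2 + 8 * τ ^ 6) * (x ^ 2 + y ^ 2 + z ^ 2) ^ 2 +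
    (96 * τ ^ 6 - 6) * (y ^ 2 * z ^ 2 + z ^ 2 * x ^ 2 + x ^ 2 * y ^ 2)) * h2

lemma vertexPowerSum_eight {τ x y z : R} (h2 : x ^ 2 + y ^ 2 + z ^ 2 = 0) :
    vertexPowerSum τ x y z 8 =
      (4 + 128 * τ ^ 8) * (y ^ 2 * z ^ 2 + z ^ 2 * x ^ 2 + x ^ 2 * y ^ 2) ^ 2 := by
  unfold vertexPowerSum
  linear_combination ((2 + 8 * τ ^ 8) * (x ^ 2 + y ^ 2 + z ^ 2) ^ 3 +
    (192 * τ ^ 8 - 8) * (x ^ 2 + y ^ 2 + z ^ 2) *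
      (y ^ 2 * z ^ 2 + z ^ 2 * x ^ 2 + x ^ 2 * y ^ 2) +
    (2048 * τ ^ 8 + 8) * (x ^ 2 * y ^ 2 * z ^ 2)) * h2

lemma vertexPowerSum_ten {τ x y z : R} (h2 : x ^ 2 + y ^ 2 + z ^ 2 = 0)
    (h6 : x ^ 2 * y ^ 2 * z ^ 2 = 0) : vertexPowerSum τ x y z 10 = 0 := by
  unfold vertexPowerSum
  linear_combination ((2 + 8 * τ ^ 10) * (x ^ 2 + y ^ 2 + z ^ 2) ^ 4 +
    (320 * τ ^ 10 - 10) * (x ^ 2 + y ^ 2 + z ^ 2) ^ 2 *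
      (y ^ 2 * z ^ 2 + z ^ 2 * x ^ 2 + x ^ 2 * y ^ 2) +
    (640 * τ ^ 10 + 10) * (y ^ 2 * z ^ 2 + z ^ 2 * x ^ 2 + x ^ 2 * y ^ 2) ^ 2 +
    (6400 * τ ^ 10 + 10) * (x ^ 2 + y ^ 2 + z ^ 2) * (x ^ 2 * y ^ 2 * z ^ 2)) * h2 +
    (5120 * τ ^ 10 - 10) * (y ^ 2 * z ^ 2 + z ^ 2 * x ^ 2 + x ^ 2 * y ^ 2) * h6

lemma vertexPowerSum_odd (τ x y z : R) {k : ℕ} (hk : Odd k) : vertexPowerSum τ x y z k = 0 := by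
  simp only [vertexPowerSum, hk.neg_pow]
  ring

lemma pow_twelve_eq_zero {x y z : R} (h2 : x ^ 2 + y ^ 2 + z ^ 2 = 0)
    (h4 : (y ^ 2 * z ^ 2 + z ^ 2 * x ^ 2 + x ^ 2 * y ^ 2) ^ 2 = 0)
    (h6 : x ^ 2 * y ^ 2 * z ^ 2 = 0) : x ^ 12 = 0 := by
  set e := y ^ 2 * z ^ 2 + z ^ 2 * x ^ 2 + x ^ 2 * y ^ 2 with he
  have hx : x ^ 6 = -e * x ^ 2 := by
    rw [he]
    linear_combination x ^ 4 * h2 + h6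
  linear_combination (x ^ 6 - e * x ^ 2) * hx + x ^ 4 * h4

lemma add_pow_twelve_eq_zero {x y z : R} (h2 : x ^ 2 + y ^ 2 + z ^ 2 = 0)
    (h4 : (y ^ 2 * z ^ 2 + z ^ 2 * x ^ 2 + x ^ 2 * y ^ 2) ^ 2 = 0)
    (h6 : x ^ 2 * y ^ 2 * z ^ 2 = 0) : (x + y + z) ^ 12 = 0 := by
  set e := y ^ 2 * z ^ 2 + z ^ 2 * x ^ 2 + x ^ 2 * y ^ 2 with he
  set u := x + y + z with hu
  have hu4 : u ^ 4 = 4 * e + 8 * (x * y * z) * u := by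
    rw [he, hu]
    linear_combination
      (x ^ 2 + y ^ 2 + z ^ 2 + 4 * (x * y + y * z + z * x)) * h2
  have hu8 : u ^ 8 = 8 * e * u ^ 4 := by
    linear_combination (u ^ 4 - 4 * e + 8 * (x * y * z) * u) * hu4 + 64 * u ^ 2 * h6 - 16 * h4
  linear_combination (u ^ 4 + 8 * e) * hu8 + 64 * u ^ 4 * h4

lemma vertexPowerSum_eq_zero {τ x y z : R} (h2 : x ^ 2 + y ^ 2 + z ^ 2 = 0)
    (h4 : (y ^ 2 * z ^ 2 + z ^ 2 * x ^ 2 + x ^ 2 * y ^ 2) ^ 2 = 0)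
    (h6 : x ^ 2 * y ^ 2 * z ^ 2 = 0)
    (hτ : (32 * τ ^ 4 - 4) * (y ^ 2 * z ^ 2 + z ^ 2 * x ^ 2 + x ^ 2 * y ^ 2) = 0)
    {k : ℕ} (hk : 0 < k) : vertexPowerSum τ x y z k = 0 := by
  rcases Nat.even_or_odd k with he | ho
  · rcases lt_or_ge k 12 with hlt | hge
    · interval_cases k
      all_goals first
        | exact absurd he (by decide)
        | exact vertexPowerSum_ten h2 h6
        | skip
      · rw [vertexPowerSum_two, h2, mul_zero]
      · rw [vertexPowerSum_four h2, hτ]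
      · rw [vertexPowerSum_six h2, h6, mul_zero]
      · rw [vertexPowerSum_eight h2, h4, mul_zero]
    · have hx : x ^ 12 = 0 := pow_twelve_eq_zero h2 h4 h6
      have hy : y ^ 12 = 0 := pow_twelve_eq_zero (y := z) (z := x)
        (by linear_combination h2) (by linear_combination h4) (by linear_combination h6)
      have hz : z ^ 12 = 0 := pow_twelve_eq_zero (y := x) (z := y)
        (by linear_combination h2) (by linear_combination h4) (by linear_combination h6)
      have h₀ : (x + y + z) ^ 12 = 0 := add_pow_twelve_eq_zero h2 h4 h6
      have h₁ : (x + y - z) ^ 12 = 0 := by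
        rw [sub_eq_add_neg]
        exact add_pow_twelve_eq_zero (by linear_combination h2) (by linear_combination h4)
          (by linear_combination h6)
      have h₂ : (x - y + z) ^ 12 = 0 := by
        rw [sub_eq_add_neg]
        exact add_pow_twelve_eq_zero (by linear_combination h2) (by linear_combination h4)
          (by linear_combination h6)
      have h₃ : (-x + y + z) ^ 12 = 0 :=
        add_pow_twelve_eq_zero (by linear_combination h2) (by linear_combination h4)
          (by linear_combination h6)
      simp only [vertexPowerSum, he.neg_pow, pow_eq_zero_of_le hge hx, pow_eq_zero_of_le hge hy,
        pow_eq_zero_of_le hge hz, pow_eq_zero_of_le hge h₀, pow_eq_zero_of_le hge h₁,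
        pow_eq_zero_of_le hge h₂, pow_eq_zero_of_le hge h₃, add_zero, mul_zero]
  · exact vertexPowerSum_odd τ x y z ho

lemma eq_zero_of_algebraMap_mul_eq_zero [Algebra ℝ R] {c : ℝ} (hc : c ≠ 0) {a : R}
    (h : algebraMap ℝ R c * a = 0) : a = 0 :=
  (hc.isUnit.map (algebraMap ℝ R)).mul_right_eq_zero.mp h

lemma vertexPowerSum_eq_zero_iff [Algebra ℝ R] (t : ℝ) (x y z : R) :
    (∀ k, 0 < k → vertexPowerSum (algebraMap ℝ R t) x y z k = 0) ↔
      x ^ 2 + y ^ 2 + z ^ 2 = 0 ∧ x ^ 2 * y ^ 2 * z ^ 2 = 0 ∧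
        (y ^ 2 * z ^ 2 + z ^ 2 * x ^ 2 + x ^ 2 * y ^ 2) ^ 2 = 0 ∧
        (8 * t ^ 4 ≠ 1 → y ^ 2 * z ^ 2 + z ^ 2 * x ^ 2 + x ^ 2 * y ^ 2 = 0) := by
  constructor
  · intro h
    have h2 : x ^ 2 + y ^ 2 + z ^ 2 = 0 := by
      refine eq_zero_of_algebraMap_mul_eq_zero (c := 2 + 8 * t ^ 2) (by positivity) ?_
      simpa [vertexPowerSum_two, map_ofNat] using h 2 (by norm_num)
    refine ⟨h2, ?_, ?_, fun ht => ?_⟩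
    · refine eq_zero_of_algebraMap_mul_eq_zero (c := 6 + 384 * t ^ 6) (by positivity) ?_
      simpa [vertexPowerSum_six h2, map_ofNat] using h 6 (by norm_num)
    · refine eq_zero_of_algebraMap_mul_eq_zero (c := 4 + 128 * t ^ 8) (by positivity) ?_
      simpa [vertexPowerSum_eight h2, map_ofNat] using h 8 (by norm_num)
    · refine eq_zero_of_algebraMap_mul_eq_zero (c := 32 * t ^ 4 - 4)
        (fun h0 => ht (by linarith)) ?_
      simpa [vertexPowerSum_four h2, map_ofNat] using h 4 (by norm_num)
  · rintro ⟨h2, h6, h4, ht⟩ k hk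
    refine vertexPowerSum_eq_zero h2 h4 h6 ?_ hk
    by_cases h : 8 * t ^ 4 = 1
    · have := congrArg (algebraMap ℝ R) h
      simp only [map_mul, map_pow, map_one, map_ofNat] at this
      linear_combination 4 * (y ^ 2 * z ^ 2 + z ^ 2 * x ^ 2 + x ^ 2 * y ^ 2) * this
    · rw [ht h, mul_zero]

end PowerSums

/-- The vertices of the isohedral triakis octahedron as a single family. -/
noncomputable def vertex (r : ℝ) :
    (Bool ⊕ Bool ⊕ Bool) ⊕ (Bool × Bool × Bool) → Fin 3 → ℝ :=
  Sum.elim (Sum.elim vA (Sum.elim vB vC)) fun d => vD r d.1 d.2.1 d.2.2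

lemma sum_vertex (r : ℝ) (F : (Fin 3 → ℝ) → ℝ) :
    ∑ i, F (vertex r i) = (∑ a : Bool, (F (vA a) + F (vB a) + F (vC a))) +
      ∑ a : Bool, ∑ b : Bool, ∑ c : Bool, F (vD r a b c) := by
  simp only [Fintype.sum_sum_type, Fintype.sum_prod_type, Fintype.sum_bool, vertex, Sum.elim_inl,
    Sum.elim_inr]
  ring

lemma card_vertex :
    Fintype.card ((Bool ⊕ Bool ⊕ Bool) ⊕ (Bool × Bool × Bool)) = 14 := by
  simp

lemma sum_linForm_vertex (r : ℝ) (k : ℕ) :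
    ∑ i, linForm (vertex r i) ^ k = vertexPowerSum (C (r / 3)) (X 0) (X 1) (X 2) k := by
  have hD : ∀ a b c, linForm (vD r a b c) =
      C (r / 3) * (C (sg a) * X 0 + C (sg b) * X 1 + C (sg c) * X 2) := fun a b c => by
    simp only [linForm, Fin.sum_univ_three, vD, mul_div_assoc, C_mul, Matrix.cons_val]
    ring
  simp only [Fintype.sum_sum_type, Fintype.sum_prod_type, Fintype.sum_bool, vertex, Sum.elim_inl,
    Sum.elim_inr, hD, mul_pow, vertexPowerSum]
  simp [linForm, Fin.sum_univ_three, vA, vB, vC, sg]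
  ring

lemma eight_mul_pow_four_eq_one_iff {r : ℝ} (hr : 0 < r) :
    8 * (r / 3) ^ 4 = 1 ↔ r = 3 * (2 : ℝ) ^ (-(3 / 4) : ℝ) := by
  have hq : ((2 : ℝ) ^ (-(3 / 4) : ℝ)) ^ 4 = 1 / 8 := by
    rw [← Real.rpow_natCast, ← Real.rpow_mul (by norm_num)]
    norm_num
  have hpos : (0 : ℝ) < 2 ^ (-(3 / 4) : ℝ) := by positivity
  constructor
  · intro h
    have : r / 3 = (2 : ℝ) ^ (-(3 / 4) : ℝ) :=
      (pow_left_inj₀ (by positivity) hpos.le (by norm_num : 4 ≠ 0)).mp (by linarith)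
    linarith
  · rintro rfl
    rw [mul_div_cancel_left₀ _ (by norm_num), hq]
    norm_num

/-- The mean value property of a polynomial expressed by the invariant differential operators. -/
lemma meanValue_vertex_iff (r : ℝ) (p : MvPolynomial (Fin 3) ℝ) :
    (∀ (x : Fin 3 → ℝ) (s : ℝ), 0 < s → ∑ i, eval (x + s • vertex r i) p = 14 * eval x p) ↔
      dop e2 p = 0 ∧ dop e6 p = 0 ∧ dop e4 (dop e4 p) = 0 ∧
        (8 * (r / 3) ^ 4 ≠ 1 → dop e4 p = 0) := by
  have h14 := meanValue_iff_powerSum (vertex r) p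
  rw [card_vertex] at h14
  push_cast at h14
  let π := Ideal.Quotient.mk (annihilatorIdeal dopHom p)
  have hmem : ∀ φ, dopHom φ p = 0 ↔ π φ = 0 := fun φ => by
    rw [Ideal.Quotient.eq_zero_iff_mem, mem_annihilatorIdeal]
  have h44 : dop e4 (dop e4 p) = dopHom (e4 ^ 2) p := by
    rw [pow_two, map_mul, dopHom_apply]
    rfl
  have hsum : ∀ k, π (∑ i, linForm (vertex r i) ^ k) =
      vertexPowerSum (algebraMap ℝ _ (r / 3)) (π (X 0)) (π (X 1)) (π (X 2)) k := fun k => by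
    rw [sum_linForm_vertex]
    simp only [vertexPowerSum, map_add, map_mul, map_pow, map_neg, map_sub]
    rfl
  rw [h14, h44, ← dopHom_apply, ← dopHom_apply, ← dopHom_apply]
  simp only [hmem, hsum]
  rw [vertexPowerSum_eq_zero_iff]
  simp only [e2, e4, e6, map_add, map_mul, map_pow]

theorem triakisOctahedron_vertex_harmonics
    (r : ℝ) (hr : 0 < r) (f : (Fin 3 → ℝ) → ℝ) (hf : Continuous f) :
    (∀ (x : Fin 3 → ℝ) (s : ℝ), 0 < s →
        f x = (1 / 14) *
          ((∑ a : Bool, (f (x + s • vA a) + f (x + s • vB a) + f (x + s • vC a))) +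
           ∑ a : Bool, ∑ b : Bool, ∑ c : Bool, f (x + s • vD r a b c))) ↔
      ((r = 3 * (2 : ℝ) ^ (-(3 / 4) : ℝ) → ∃ p : MvPolynomial (Fin 3) ℝ,
          dop e2 p = 0 ∧ dop e6 p = 0 ∧ dop e4 (dop e4 p) = 0 ∧ ∀ x, f x = eval x p) ∧
       (r ≠ 3 * (2 : ℝ) ^ (-(3 / 4) : ℝ) → ∃ p : MvPolynomial (Fin 3) ℝ,
          dop e2 p = 0 ∧ dop e4 p = 0 ∧ dop e6 p = 0 ∧ ∀ x, f x = eval x p)) := by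
  have hmv : (∀ (x : Fin 3 → ℝ) (s : ℝ), 0 < s →
        f x = (1 / 14) *
          ((∑ a : Bool, (f (x + s • vA a) + f (x + s • vB a) + f (x + s • vC a))) +
           ∑ a : Bool, ∑ b : Bool, ∑ c : Bool, f (x + s • vD r a b c))) ↔
      ∀ (x : Fin 3 → ℝ) (s : ℝ), 0 < s → ∑ i, f (x + s • vertex r i) = 14 * f x := by
    refine forall₃_congr fun x s _ => ?_
    rw [sum_vertex r fun v => f (x + s • v)]
    constructor <;> intro h <;> linarith
  have hpoly : (∀ (x : Fin 3 → ℝ) (s : ℝ), 0 < s → ∑ i, f (x + s • vertex r i) = 14 * f x) ↔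
      ∃ p : MvPolynomial (Fin 3) ℝ, (dop e2 p = 0 ∧ dop e6 p = 0 ∧ dop e4 (dop e4 p) = 0 ∧
        (8 * (r / 3) ^ 4 ≠ 1 → dop e4 p = 0)) ∧ ∀ x, f x = eval x p := by
    constructor
    · intro h
      have hdiff : ∀ (s : ℝ), 0 < s → ∀ i, Δ_[s • vertex r i] ^[14] f = 0 := fun s hs i => by
        refine card_vertex ▸ fwdDiff_iter_card_eq_zero (fun i => s • vertex r i) f ?_ i
        intro x k hk
        rw [card_vertex]
        simpa [← Nat.cast_smul_eq_nsmul ℝ, smul_smul] using h x (k * s) (by positivity)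
      obtain ⟨p, hp⟩ := exists_mvPolynomial_of_fwdDiff_iter_eq_zero (n := 14) hf (by
        intro i s hs
        fin_cases i
        · convert hdiff s hs (.inl (.inl true)) using 3
          ext l; fin_cases l <;> simp [vertex, vA, sg]
        · convert hdiff s hs (.inl (.inr (.inl true))) using 3
          ext l; fin_cases l <;> simp [vertex, vB, sg]
        · convert hdiff s hs (.inl (.inr (.inr true))) using 3
          ext l; fin_cases l <;> simp [vertex, vC, sg])
      refine ⟨p, (meanValue_vertex_iff r p).mp fun x s hs => ?_, hp⟩
      simpa only [hp] using h x s hs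
    · rintro ⟨p, hp, hfp⟩ x s hs
      simpa only [hfp] using (meanValue_vertex_iff r p).mpr hp x s hs
  rw [hmv, hpoly]
  simp only [ne_eq, eight_mul_pow_four_eq_one_iff hr]
  by_cases h : r = 3 * (2 : ℝ) ^ (-(3 / 4) : ℝ)
  · simp [h, and_assoc]
  · simp only [h, not_false_eq_true, forall_const, false_imp_iff, true_and]
    refine exists_congr fun p => ?_
    constructor
    · rintro ⟨⟨h2, h6, -, h4⟩, hfp⟩
      exact ⟨h2, h4, h6, hfp⟩
    · rintro ⟨h2, h4, h6, hfp⟩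
      exact ⟨⟨h2, h6, by rw [h4, map_zero], h4⟩, hfp⟩
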